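/- arXiv:0812.3651 — 2 statements merged into one kernel-verified Lean document; each statement's English description precedes it below -/
import Mathlib

section
/- If δ is a bounded continuous function on D, then for every (a,b,c) ∈ D the function r ↦ φ_{2,δ}(a,b,c,r) is continuous on [0,c] and attains its maximum there, and the function (Φ_2 δ)(a,b,c) = max_{0 ≤ r ≤ c} φ_{2,δ}(a,b,c,r) is again bounded and continuous on D; that is, the operator Φ_2 maps the Banach space B of bounded continuous real-valued functions on D (with the supremum norm) into itself. -/
open MeasureTheory Set Filter Topology
open scoped Classical

noncomputable section

/-- The domain `D = {(a,b,c) ∈ [0,∞) × [0,t₀] × [0,t₀] : b + c ≤ t₀}`. -/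
def Dset (t0 : ℝ) : Set (ℝ × ℝ × ℝ) :=
  {p | 0 ≤ p.1 ∧ p.2.1 ∈ Icc (0 : ℝ) t0 ∧ p.2.2 ∈ Icc (0 : ℝ) t0 ∧ p.2.1 + p.2.2 ≤ t0}

/-- Extension (by `0`) of a bounded continuous function on `D` to all of `ℝ³`. -/
def extD {t0 : ℝ} (δ : BoundedContinuousFunction (Dset t0) ℝ) : ℝ × ℝ × ℝ → ℝ :=
  fun p => if h : p ∈ Dset t0 then δ ⟨p, h⟩ else 0

/-- `Δ₂(a) = E[g₂(a + X₂) - g₂(a)]`, where `ν` is the law of the fish weight `X₂`. -/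
def DeltaFn (g : ℝ → ℝ) (ν : Measure ℝ) (a : ℝ) : ℝ := ∫ x, (g (a + x) - g a) ∂ν

/-- `φ_{2,δ}(a,b,c,r) = ∫_0^r (1-F₂(z)) { α₂(z)[Δ₂(a) + ∫ δ(a+x,b+z,c-z) dH₂(x)] - c₂'(b+z) } dz`,
with `α₂ = f₂ / (1 - F₂)` and `ν` the law of the fish weight. -/
def phiFn (F2 f2 g2 c2 : ℝ → ℝ) (ν : Measure ℝ) (δ : ℝ × ℝ × ℝ → ℝ) (a b c r : ℝ) : ℝ :=
  ∫ z in Ioc (0 : ℝ) r,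
    (1 - F2 z) * (f2 z / (1 - F2 z) * (DeltaFn g2 ν a + ∫ x, δ (a + x, b + z, c - z) ∂ν)
      - deriv c2 (b + z))

/-- A bounded jointly continuous function integrates to a continuous function. -/
theorem continuous_K (ν : Measure ℝ) [IsProbabilityMeasure ν] {Y : Type*} [TopologicalSpace Y]
    [FirstCountableTopology Y] (k : Y → ℝ → ℝ) (hk : Continuous (fun q : Y × ℝ => k q.1 q.2))
    (M : ℝ) (hM : ∀ y x, |k y x| ≤ M) :
    Continuous (fun y => ∫ x, k y x ∂ν) := by
  refine continuous_of_dominated (bound := fun _ => M) ?_ ?_ (integrable_const M) ?_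
  · intro y
    exact (hk.comp (by fun_prop : Continuous fun x : ℝ => (y, x))).aestronglyMeasurable
  · intro y
    exact ae_of_all _ (fun x => hM y x)
  · exact ae_of_all _ (fun x => hk.comp (by fun_prop : Continuous fun y : Y => (y, x)))

theorem bound_K (ν : Measure ℝ) [IsProbabilityMeasure ν] (k : ℝ → ℝ)
    (M : ℝ) (hM : ∀ x, |k x| ≤ M) : |∫ x, k x ∂ν| ≤ M := by
  have := norm_integral_le_of_norm_le_const (μ := ν) (f := k) (C := M) (ae_of_all _ hM)
  simpa using this

theorem isClosed_Dset (t0 : ℝ) : IsClosed (Dset t0) := by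
  have h1 : IsClosed {p : ℝ × ℝ × ℝ | 0 ≤ p.1} := isClosed_le (by fun_prop) (by fun_prop)
  have h2 : IsClosed {p : ℝ × ℝ × ℝ | p.2.1 ∈ Icc (0 : ℝ) t0} :=
    isClosed_Icc.preimage (by fun_prop : Continuous fun p : ℝ × ℝ × ℝ => p.2.1)
  have h3 : IsClosed {p : ℝ × ℝ × ℝ | p.2.2 ∈ Icc (0 : ℝ) t0} :=
    isClosed_Icc.preimage (by fun_prop : Continuous fun p : ℝ × ℝ × ℝ => p.2.2)
  have h4 : IsClosed {p : ℝ × ℝ × ℝ | p.2.1 + p.2.2 ≤ t0} :=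
    isClosed_le (by fun_prop) (by fun_prop)
  exact h1.inter (h2.inter (h3.inter h4))

/-- Regularised integrand properties: joint continuity of the primitive, and a bound. -/
theorem continuous_psi (F f d : ℝ → ℝ) (hf : ∀ z, 0 ≤ f z) (hfm : Measurable f)
    (hfi : ∀ u v, IntervalIntegrable f volume u v) (hFm : Measurable F)
    (hF : ∀ z, |1 - F z| ≤ 1) (hd : Continuous d) (L : ℝ) (hL : ∀ t, |d t| ≤ L)
    (K : (ℝ × ℝ × ℝ) × ℝ → ℝ) (hK : Continuous K) (M : ℝ) (hM : ∀ q, |K q| ≤ M) :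
    Continuous (fun q : (ℝ × ℝ × ℝ) × ℝ =>
      ∫ z in (0:ℝ)..q.2, (f z * K (q.1, z) - (1 - F z) * d (q.1.2.1 + z))) ∧
    ∀ t0 : ℝ, ∀ p : ℝ × ℝ × ℝ, ∀ r ∈ Icc 0 t0,
      |∫ z in (0:ℝ)..r, (f z * K (p, z) - (1 - F z) * d (p.2.1 + z))| ≤
        ∫ z in (0:ℝ)..t0, (f z * M + L) := by
  have hb : ∀ u v, IntervalIntegrable (fun z => f z * M + L) volume u v := fun u v =>
    ((hfi u v).mul_const M).add intervalIntegrable_const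
  have hle : ∀ p z, ‖f z * K (p, z) - (1 - F z) * d (p.2.1 + z)‖ ≤ f z * M + L := by
    intro p z
    have h1 : |f z * K (p, z)| ≤ f z * M := by
      rw [abs_mul, abs_of_nonneg (hf z)]
      exact mul_le_mul_of_nonneg_left (hM _) (hf z)
    have h2 : |(1 - F z) * d (p.2.1 + z)| ≤ L := by
      rw [abs_mul]
      calc _ ≤ 1 * L := mul_le_mul (hF z) (hL _) (abs_nonneg _) zero_le_one
        _ = L := one_mul L
    exact (abs_sub _ _).trans (add_le_add h1 h2)
  have hmeas : ∀ p : ℝ × ℝ × ℝ, Measurable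
      (fun z => f z * K (p, z) - (1 - F z) * d (p.2.1 + z)) := by
    intro p
    have h1 : Measurable fun z => K (p, z) :=
      (hK.comp (by fun_prop : Continuous fun z : ℝ => (p, z))).measurable
    have h2 : Measurable fun z => d (p.2.1 + z) :=
      (hd.comp (by fun_prop : Continuous fun z : ℝ => p.2.1 + z)).measurable
    fun_prop
  refine ⟨?_, ?_⟩
  · rw [continuous_iff_continuousAt]
    rintro ⟨p, r⟩
    have := intervalIntegral.continuousAt_parametric_primitive_of_dominated (μ := volume)
      (F := fun (p : ℝ × ℝ × ℝ) z => f z * K (p, z) - (1 - F z) * d (p.2.1 + z))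
      (fun z => f z * M + L) (min 0 r - 1) (max 0 r + 1) (a₀ := 0) (b₀ := r) (x₀ := p)
      (fun p => (hmeas p).aestronglyMeasurable)
      (Eventually.of_forall fun p => ae_of_all _ (hle p)) (hb _ _)
      (ae_of_all _ fun z => by
        have : Continuous fun p : ℝ × ℝ × ℝ => f z * K (p, z) - (1 - F z) * d (p.2.1 + z) := by
          fun_prop
        exact this.continuousAt)
      ⟨by linarith [min_le_left 0 r], by linarith [le_max_left 0 r]⟩
      ⟨by linarith [min_le_right 0 r], by linarith [le_max_right 0 r]⟩ (by simp)
    exact this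
  · intro t0 p r hr
    have h0 : ∀ z, 0 ≤ f z * M + L := fun z => (norm_nonneg _).trans (hle p z)
    calc _ ≤ ∫ z in (0:ℝ)..r, (f z * M + L) :=
          intervalIntegral.norm_integral_le_of_norm_le hr.1 (ae_of_all _ fun z _ => hle p z) (hb _ _)
      _ ≤ _ := intervalIntegral.integral_mono_interval le_rfl hr.1 hr.2
          (ae_of_all _ h0) (hb _ _)

theorem cdf_facts (F2 f2 : ℝ → ℝ) (hf2nn : ∀ z, 0 ≤ f2 z)
    (hF2 : ∀ z, F2 z = ∫ x in Iic z, f2 x)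
    (hF2one : Tendsto F2 atTop (nhds 1)) :
    (∀ z, IntegrableOn f2 (Iic z)) ∧ Monotone F2 ∧ ∀ z, |1 - F2 z| ≤ 1 := by
  have hi : ∀ z, IntegrableOn f2 (Iic z) := by
    intro z
    by_contra hz
    have h0 : ∀ᶠ y in atTop, F2 y = 0 := by
      filter_upwards [eventually_ge_atTop z] with y hy
      rw [hF2]
      exact integral_undef (fun h => hz (IntegrableOn.mono_set h (Iic_subset_Iic.2 hy)))
    have := tendsto_nhds_unique (hF2one.congr' h0) tendsto_const_nhds
    norm_num at this
  have hm : Monotone F2 := by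
    intro x y hxy
    rw [hF2, hF2]
    exact setIntegral_mono_set (hi y) (ae_of_all _ hf2nn) (Iic_subset_Iic.2 hxy).eventuallyLE
  refine ⟨hi, hm, fun z => ?_⟩
  have h1 := hm.ge_of_tendsto hF2one z
  have h0 : 0 ≤ F2 z := by rw [hF2]; exact integral_nonneg hf2nn
  rw [abs_le]; constructor <;> linarith

/-- **`Φ₂` maps `B` into `B`** : for bounded continuous `δ` on `D`, the map
`r ↦ φ_{2,δ}(a,b,c,r)` is continuous on `[0,c]` and attains its maximum there, and
`(Φ₂δ)(a,b,c) = max_{0 ≤ r ≤ c} φ_{2,δ}(a,b,c,r)` is again a bounded continuous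
function on `D`. -/
theorem Phi2_maps_B_to_B
    (t0 G2 C2 : ℝ) (ht0 : 0 < t0)
    (F2 f2 : ℝ → ℝ) (hf2nn : ∀ z, 0 ≤ f2 z) (hf2m : Measurable f2)
    (hF2 : ∀ z, F2 z = ∫ x in Iic z, f2 x)
    (hF2one : Tendsto F2 atTop (nhds 1)) (hF2t0 : F2 t0 < 1)
    (ν : Measure ℝ) [IsProbabilityMeasure ν] (hν : ν (Iio 0) = 0)
    (g2 c2 : ℝ → ℝ) (hg2c : Continuous g2)
    (hg2b : ∀ x ∈ Ici (0 : ℝ), g2 x ∈ Icc 0 G2)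
    (hc2c : Continuous c2) (hc2d : Differentiable ℝ c2)
    (hc2dc : Continuous (deriv c2)) (hc2db : ∃ L, ∀ t, |deriv c2 t| ≤ L)
    (hc2b : ∀ t ∈ Icc (0 : ℝ) t0, c2 t ∈ Icc 0 C2)
    (δ : BoundedContinuousFunction (Dset t0) ℝ) :
    (∀ p ∈ Dset t0,
        ContinuousOn (fun r => phiFn F2 f2 g2 c2 ν (extD δ) p.1 p.2.1 p.2.2 r)
          (Icc 0 p.2.2) ∧
        ∃ r ∈ Icc (0 : ℝ) p.2.2,
          IsGreatest ((fun r => phiFn F2 f2 g2 c2 ν (extD δ) p.1 p.2.1 p.2.2 r) ''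
            Icc 0 p.2.2) (phiFn F2 f2 g2 c2 ν (extD δ) p.1 p.2.1 p.2.2 r)) ∧
    ∃ Φδ : BoundedContinuousFunction (Dset t0) ℝ, ∀ q : Dset t0,
      Φδ q = sSup ((fun r => phiFn F2 f2 g2 c2 ν (extD δ)
        (q : ℝ × ℝ × ℝ).1 (q : ℝ × ℝ × ℝ).2.1 (q : ℝ × ℝ × ℝ).2.2 r) ''
        Icc 0 (q : ℝ × ℝ × ℝ).2.2) := by
  obtain ⟨hi, hmono, hF01⟩ := cdf_facts F2 f2 hf2nn hF2 hF2one
  obtain ⟨L, hL⟩ := hc2db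
  obtain ⟨e, -, he⟩ := BoundedContinuousFunction.exists_extension_norm_eq_of_isClosedEmbedding
    δ (isClosed_Dset t0).isClosedEmbedding_subtypeVal
  have hfi : ∀ u v, IntervalIntegrable f2 volume u v := fun u v =>
    ⟨(hi v).mono_set (fun x hx => hx.2), (hi u).mono_set (fun x hx => hx.2)⟩
  set g : ℝ → ℝ := fun x => g2 (max x 0) with hg
  have hgc : Continuous g := by fun_prop
  have hgb : ∀ x y, |g x - g y| ≤ G2 := by
    intro x y
    have h1 := hg2b (max x 0) (mem_Ici.2 (le_max_right _ _))
    have h2 := hg2b (max y 0) (mem_Ici.2 (le_max_right _ _))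
    simp only [hg, mem_Icc] at *
    rw [abs_le]; constructor <;> linarith
  set K : (ℝ × ℝ × ℝ) × ℝ → ℝ := fun q => (∫ x, (g (q.1.1 + x) - g q.1.1) ∂ν) +
    ∫ x, e (q.1.1 + x, q.1.2.1 + q.2, q.1.2.2 - q.2) ∂ν with hKdef
  have hK : Continuous K := by
    refine Continuous.add ?_ ?_
    · exact continuous_K ν (fun (q : (ℝ × ℝ × ℝ) × ℝ) x => g (q.1.1 + x) - g q.1.1)
        (by fun_prop) G2 (fun _ _ => hgb _ _)
    · exact continuous_K ν (fun (q : (ℝ × ℝ × ℝ) × ℝ) x =>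
        e (q.1.1 + x, q.1.2.1 + q.2, q.1.2.2 - q.2))
        (by fun_prop) ‖e‖ (fun _ _ => e.norm_coe_le_norm _)
  have hKb : ∀ q, |K q| ≤ G2 + ‖e‖ := fun q => (abs_add_le _ _).trans
    (add_le_add (bound_K ν _ _ fun _ => hgb _ _) (bound_K ν _ _ fun _ => e.norm_coe_le_norm _))
  obtain ⟨hψc, hψb⟩ := continuous_psi F2 f2 (deriv c2) hf2nn hf2m hfi hmono.measurable hF01
    hc2dc L hL K hK _ hKb
  set ψ : (ℝ × ℝ × ℝ) × ℝ → ℝ := fun q =>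
    ∫ z in (0:ℝ)..q.2, (f2 z * K (q.1, z) - (1 - F2 z) * deriv c2 (q.1.2.1 + z)) with hψ
  have hνae : ∀ᵐ x ∂ν, 0 ≤ x := by
    rw [ae_iff]
    simpa [Iio] using hν
  have key : ∀ p ∈ Dset t0, ∀ r ∈ Icc (0:ℝ) p.2.2,
      phiFn F2 f2 g2 c2 ν (extD δ) p.1 p.2.1 p.2.2 r = ψ (p, r) := by
    rintro ⟨a, b, c⟩ ⟨ha, hb, hc, hbc⟩ r hr
    simp only at ha hb hc hbc hr
    simp only [hψ, phiFn]
    rw [intervalIntegral.integral_of_le hr.1]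
    refine setIntegral_congr_fun measurableSet_Ioc (fun z hz => ?_)
    have hzt : z ≤ t0 := hz.2.trans (hr.2.trans hc.2)
    have hne : 1 - F2 z ≠ 0 := by
      have := hmono hzt
      linarith
    have hD : DeltaFn g2 ν a = ∫ x, (g (a + x) - g a) ∂ν := by
      refine integral_congr_ae ?_
      filter_upwards [hνae] with x hx
      simp only [hg]
      rw [max_eq_left ha, max_eq_left (add_nonneg ha hx)]
    have hE : (∫ x, extD δ (a + x, b + z, c - z) ∂ν) = ∫ x, e (a + x, b + z, c - z) ∂ν := by
      refine integral_congr_ae ?_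
      filter_upwards [hνae] with x hx
      have hmem : ((a + x, b + z, c - z) : ℝ × ℝ × ℝ) ∈ Dset t0 := by
        have := hz.1
        have := hz.2
        have := hr.2
        have := hb.1
        have := hc.2
        refine ⟨?_, ⟨?_, ?_⟩, ⟨?_, ?_⟩, ?_⟩ <;> simp only <;> linarith
      simp only [extD, dif_pos hmem]
      rw [← he]
      rfl
    simp only [hKdef]
    rw [hD, hE]
    field_simp
  have himg : ∀ p ∈ Dset t0,
      (fun r => phiFn F2 f2 g2 c2 ν (extD δ) p.1 p.2.1 p.2.2 r) '' Icc 0 p.2.2 =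
      (fun s => ψ (p, p.2.2 * s)) '' Icc 0 1 := by
    intro p hp
    have hc : 0 ≤ p.2.2 := hp.2.2.1.1
    rw [image_congr (key p hp)]
    have : Icc 0 p.2.2 = (fun s => p.2.2 * s) '' Icc (0:ℝ) 1 := by
      rw [image_mul_left_Icc hc zero_le_one]; simp
    rw [this, image_image]
  refine ⟨fun p hp => ?_, ?_⟩
  · have hcont : ContinuousOn (fun r => phiFn F2 f2 g2 c2 ν (extD δ) p.1 p.2.1 p.2.2 r)
        (Icc 0 p.2.2) :=
      ContinuousOn.congr (hψc.comp (by fun_prop : Continuous fun r : ℝ => (p, r))).continuousOn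
        (key p hp)
    refine ⟨hcont, ?_⟩
    obtain ⟨r, hr, hmax⟩ := isCompact_Icc.exists_isMaxOn (nonempty_Icc.2 hp.2.2.1.1) hcont
    refine ⟨r, hr, mem_image_of_mem _ hr, ?_⟩
    rintro _ ⟨s, hs, rfl⟩
    exact hmax hs
  · have hS : Continuous fun q : Dset t0 =>
        sSup ((fun s => ψ ((q : ℝ × ℝ × ℝ), (q : ℝ × ℝ × ℝ).2.2 * s)) '' Icc (0:ℝ) 1) := by
      refine isCompact_Icc.continuous_sSup
        (f := fun (q : Dset t0) s => ψ ((q : ℝ × ℝ × ℝ), (q : ℝ × ℝ × ℝ).2.2 * s)) ?_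
      exact hψc.comp (by fun_prop : Continuous fun w : Dset t0 × ℝ =>
        ((w.1 : ℝ × ℝ × ℝ), (w.1 : ℝ × ℝ × ℝ).2.2 * w.2))
    refine ⟨BoundedContinuousFunction.ofNormedAddCommGroup _ hS
      (∫ z in (0:ℝ)..t0, (f2 z * (G2 + ‖e‖) + L)) ?_, ?_⟩
    · rintro ⟨p, hp⟩
      have hbd : ∀ s ∈ Icc (0:ℝ) 1, |ψ (p, p.2.2 * s)| ≤
          ∫ z in (0:ℝ)..t0, (f2 z * (G2 + ‖e‖) + L) := by
        intro s hs
        have hc := hp.2.2.1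
        exact hψb t0 p _ ⟨mul_nonneg hc.1 hs.1,
          (mul_le_of_le_one_right hc.1 hs.2).trans hc.2⟩
      have h0 : (0:ℝ) ∈ Icc (0:ℝ) 1 := ⟨le_rfl, zero_le_one⟩
      rw [Real.norm_eq_abs, abs_le]
      constructor
      · refine (abs_le.1 (hbd 0 h0)).1.trans (le_csSup ?_ (mem_image_of_mem _ h0))
        refine ⟨∫ z in (0:ℝ)..t0, (f2 z * (G2 + ‖e‖) + L), ?_⟩
        rintro _ ⟨s, hs, rfl⟩
        exact (abs_le.1 (hbd s hs)).2
      · refine csSup_le ⟨_, mem_image_of_mem _ h0⟩ ?_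
        rintro _ ⟨s, hs, rfl⟩
        exact (abs_le.1 (hbd s hs)).2
    · intro q
      rw [himg q q.2]
      rfl
end
end

section
/- If F_2(t_0) < 1, then the operator Φ_2 defined by (Φ_2 δ)(a,b,c) = max_{0 ≤ r ≤ c} φ_{2,δ}(a,b,c,r) is a contraction on the Banach space B: for all δ, δ' ∈ B one has ‖Φ_2 δ − Φ_2 δ'‖ ≤ F_2(t_0) · ‖δ − δ'‖, where ‖·‖ is the supremum norm on D. -/
open MeasureTheory Set Filter Topology
open scoped Classical

noncomputable section

theorem extD_measurable {t0 : ℝ} (δ : BoundedContinuousFunction (Dset t0) ℝ) :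
    Measurable (extD δ) := by
  have hD : MeasurableSet (Dset t0) := by
    unfold Dset
    simp only [mem_Icc]
    apply IsClosed.measurableSet
    refine IsClosed.and (isClosed_le (by fun_prop) (by fun_prop)) ?_
    refine IsClosed.and (IsClosed.and (isClosed_le (by fun_prop) (by fun_prop))
      (isClosed_le (by fun_prop) (by fun_prop))) ?_
    refine IsClosed.and (IsClosed.and (isClosed_le (by fun_prop) (by fun_prop))
      (isClosed_le (by fun_prop) (by fun_prop))) (isClosed_le (by fun_prop) (by fun_prop))
  unfold extD
  exact Measurable.dite (f := fun p : Dset t0 => δ p) (g := fun _ => (0 : ℝ))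
    δ.continuous.measurable measurable_const hD

theorem extD_sub_bound {t0 : ℝ} (δ δ' : BoundedContinuousFunction (Dset t0) ℝ)
    (p : ℝ × ℝ × ℝ) : |extD δ p - extD δ' p| ≤ ‖δ - δ'‖ := by
  unfold extD
  split_ifs with h
  · exact (δ - δ').norm_coe_le_norm ⟨p, h⟩
  · simp

theorem extD_bound {t0 : ℝ} (δ : BoundedContinuousFunction (Dset t0) ℝ)
    (p : ℝ × ℝ × ℝ) : |extD δ p| ≤ ‖δ‖ := by
  unfold extD
  split_ifs with h
  · exact δ.norm_coe_le_norm ⟨p, h⟩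
  · simp

theorem inner_measurable {t0 : ℝ} (δ : BoundedContinuousFunction (Dset t0) ℝ)
    (ν : Measure ℝ) [IsProbabilityMeasure ν] (a b c : ℝ) :
    StronglyMeasurable (fun z => ∫ x, extD δ (a + x, b + z, c - z) ∂ν) := by
  have : Measurable (fun p : ℝ × ℝ => extD δ (a + p.2, b + p.1, c - p.1)) :=
    (extD_measurable δ).comp (by fun_prop)
  exact this.stronglyMeasurable.integral_prod_right

theorem inner_integrable {t0 : ℝ} (δ : BoundedContinuousFunction (Dset t0) ℝ)
    (ν : Measure ℝ) [IsProbabilityMeasure ν] (a b c z : ℝ) :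
    Integrable (fun x => extD δ (a + x, b + z, c - z)) ν := by
  have : Measurable (fun x : ℝ => extD δ (a + x, b + z, c - z)) :=
    (extD_measurable δ).comp (by fun_prop)
  exact Integrable.of_bound this.aestronglyMeasurable ‖δ‖
    (Eventually.of_forall fun x => extD_bound δ _)

theorem inner_bound {t0 : ℝ} (δ : BoundedContinuousFunction (Dset t0) ℝ)
    (ν : Measure ℝ) [IsProbabilityMeasure ν] (a b c z : ℝ) :
    |∫ x, extD δ (a + x, b + z, c - z) ∂ν| ≤ ‖δ‖ := by
  have := norm_integral_le_of_norm_le_const (μ := ν)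
    (f := fun x => extD δ (a + x, b + z, c - z)) (C := ‖δ‖)
    (Eventually.of_forall fun x => extD_bound δ _)
  simpa using this

theorem inner_sub_bound {t0 : ℝ} (δ δ' : BoundedContinuousFunction (Dset t0) ℝ)
    (ν : Measure ℝ) [IsProbabilityMeasure ν] (a b c z : ℝ) :
    |∫ x, extD δ (a + x, b + z, c - z) ∂ν - ∫ x, extD δ' (a + x, b + z, c - z) ∂ν|
      ≤ ‖δ - δ'‖ := by
  rw [← integral_sub (inner_integrable δ ν a b c z) (inner_integrable δ' ν a b c z)]
  have := norm_integral_le_of_norm_le_const (μ := ν)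
    (f := fun x => extD δ (a + x, b + z, c - z) - extD δ' (a + x, b + z, c - z))
    (C := ‖δ - δ'‖) (Eventually.of_forall fun x => extD_sub_bound δ δ' _)
  simpa using this

/-- **`Φ₂` is a contraction**: if `F₂(t₀) < 1` then for the operator
`(Φ₂δ)(a,b,c) = max_{0 ≤ r ≤ c} φ_{2,δ}(a,b,c,r)` on the Banach space `B` of bounded
continuous functions on `D` with the supremum norm, one has
`‖Φ₂δ - Φ₂δ'‖ ≤ F₂(t₀) ‖δ - δ'‖` for all `δ, δ' ∈ B`. -/
theorem Phi2_contraction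
    (t0 G2 C2 : ℝ) (ht0 : 0 < t0)
    (F2 f2 : ℝ → ℝ) (hf2nn : ∀ z, 0 ≤ f2 z) (hf2m : Measurable f2)
    (hF2 : ∀ z, F2 z = ∫ x in Iic z, f2 x)
    (hF2one : Tendsto F2 atTop (nhds 1)) (hF2t0 : F2 t0 < 1)
    (ν : Measure ℝ) [IsProbabilityMeasure ν] (hν : ν (Iio 0) = 0)
    (g2 c2 : ℝ → ℝ) (hg2c : Continuous g2)
    (hg2b : ∀ x ∈ Ici (0 : ℝ), g2 x ∈ Icc 0 G2)
    (hc2c : Continuous c2) (hc2d : Differentiable ℝ c2)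
    (hc2dc : Continuous (deriv c2)) (hc2db : ∃ L, ∀ t, |deriv c2 t| ≤ L)
    (hc2b : ∀ t ∈ Icc (0 : ℝ) t0, c2 t ∈ Icc 0 C2)
    (Phi : BoundedContinuousFunction (Dset t0) ℝ → BoundedContinuousFunction (Dset t0) ℝ)
    (hPhi : ∀ (δ : BoundedContinuousFunction (Dset t0) ℝ) (q : Dset t0),
      Phi δ q = sSup ((fun r => phiFn F2 f2 g2 c2 ν (extD δ)
        (q : ℝ × ℝ × ℝ).1 (q : ℝ × ℝ × ℝ).2.1 (q : ℝ × ℝ × ℝ).2.2 r) ''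
        Icc 0 (q : ℝ × ℝ × ℝ).2.2)) :
    ∀ δ δ' : BoundedContinuousFunction (Dset t0) ℝ,
      ‖Phi δ - Phi δ'‖ ≤ F2 t0 * ‖δ - δ'‖ := by
  have hint : ∀ z, IntegrableOn f2 (Iic z) := by
    intro z
    obtain ⟨w, hw, hzw⟩ := ((hF2one.eventually (lt_mem_nhds zero_lt_one)).and
      (eventually_ge_atTop z)).exists
    have : IntegrableOn f2 (Iic w) := by
      by_contra hcon
      rw [hF2, integral_undef hcon] at hw
      exact lt_irrefl _ hw
    exact this.mono_set (Iic_subset_Iic.2 hzw)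
  have hmono : Monotone F2 := by
    intro x y hxy
    rw [hF2, hF2]
    exact setIntegral_mono_set (hint y) (Eventually.of_forall hf2nn)
      (Iic_subset_Iic.2 hxy).eventuallyLE
  have hF0 : ∀ z, 0 ≤ F2 z := fun z => by
    rw [hF2]; exact integral_nonneg hf2nn
  obtain ⟨L, hL⟩ := hc2db
  -- integrability of the integrand
  have hI : ∀ (δ : BoundedContinuousFunction (Dset t0) ℝ) (a b c r : ℝ), r ≤ t0 →
      IntegrableOn (fun z => (1 - F2 z) * (f2 z / (1 - F2 z) *
        (DeltaFn g2 ν a + ∫ x, extD δ (a + x, b + z, c - z) ∂ν) - deriv c2 (b + z)))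
        (Ioc 0 r) := by
    intro δ a b c r hr
    have h1 : IntegrableOn (fun z =>
        (DeltaFn g2 ν a + ∫ x, extD δ (a + x, b + z, c - z) ∂ν) * f2 z) (Ioc 0 r) := by
      apply Integrable.bdd_mul (c := |DeltaFn g2 ν a| + ‖δ‖)
      · exact (hint r).mono_set Ioc_subset_Iic_self
      · exact (stronglyMeasurable_const.add (inner_measurable δ ν a b c)).aestronglyMeasurable
      · refine Eventually.of_forall fun z => ?_
        exact (abs_add_le _ _).trans (by gcongr; exact inner_bound δ ν a b c z)
    have h2 : IntegrableOn (fun z => (1 - F2 z) * deriv c2 (b + z)) (Ioc 0 r) := by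
      refine Measure.integrableOn_of_bounded (M := L) (by simp) ?_ ?_
      · have := hmono.measurable
        have := hc2dc.measurable
        apply Measurable.aestronglyMeasurable
        fun_prop
      · refine (ae_restrict_iff' measurableSet_Ioc).2 (Eventually.of_forall fun z hz => ?_)
        have := hmono (hz.2.trans hr)
        have h0 := hF0 z
        rw [Real.norm_eq_abs, abs_mul, abs_of_nonneg (by linarith)]
        have := hL (b + z)
        nlinarith [abs_nonneg (deriv c2 (b + z))]
    refine (h1.sub h2).congr_fun (fun z hz => ?_) measurableSet_Ioc
    have := hmono (hz.2.trans hr)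
    have hne : 1 - F2 z ≠ 0 := by linarith
    simp only [Pi.sub_apply]
    field_simp
  -- pointwise comparison
  have hcmp : ∀ (δ δ' : BoundedContinuousFunction (Dset t0) ℝ) (a b c r : ℝ), r ≤ t0 →
      phiFn F2 f2 g2 c2 ν (extD δ) a b c r ≤
        phiFn F2 f2 g2 c2 ν (extD δ') a b c r + F2 t0 * ‖δ - δ'‖ := by
    intro δ δ' a b c r hr
    have hf : IntegrableOn f2 (Ioc 0 r) := (hint r).mono_set Ioc_subset_Iic_self
    have hle : ∫ z in Ioc 0 r, f2 z ≤ F2 t0 := by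
      rw [hF2]
      exact setIntegral_mono_set (hint t0) (Eventually.of_forall hf2nn)
        (HasSubset.Subset.eventuallyLE (fun z hz => hz.2.trans hr))
    have key : phiFn F2 f2 g2 c2 ν (extD δ) a b c r - phiFn F2 f2 g2 c2 ν (extD δ') a b c r
        ≤ ∫ z in Ioc 0 r, f2 z * ‖δ - δ'‖ := by
      unfold phiFn
      rw [← integral_sub (hI δ a b c r hr) (hI δ' a b c r hr)]
      refine setIntegral_mono_on ((hI δ a b c r hr).sub (hI δ' a b c r hr))
        (hf.mul_const _) measurableSet_Ioc fun z hz => ?_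
      have := hmono (hz.2.trans hr)
      have hne : 1 - F2 z ≠ 0 := by linarith
      have hb := (le_abs_self _).trans (inner_sub_bound δ δ' ν a b c z)
      have := mul_le_mul_of_nonneg_left hb (hf2nn z)
      refine le_trans (le_of_eq ?_) this
      field_simp
      ring
    rw [integral_mul_const] at key
    have := mul_le_mul_of_nonneg_right hle (norm_nonneg (δ - δ'))
    linarith
  have hone : ∀ (δ δ' : BoundedContinuousFunction (Dset t0) ℝ) (q : Dset t0),
      Phi δ q ≤ Phi δ' q + F2 t0 * ‖δ - δ'‖ := by
    rintro δ δ' ⟨⟨a, b, c⟩, hq⟩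
    rw [hPhi, hPhi]
    have hc : c ∈ Icc 0 t0 := hq.2.2.1
    apply csSup_le ((nonempty_Icc.2 hc.1).image _)
    rintro _ ⟨r, hr, rfl⟩
    refine (hcmp δ δ' a b c r (hr.2.trans hc.2)).trans ?_
    gcongr
    refine le_csSup ?_ ⟨r, hr, rfl⟩
    refine ⟨∫ z in Ioc 0 c, ‖(1 - F2 z) * (f2 z / (1 - F2 z) *
        (DeltaFn g2 ν a + ∫ x, extD δ' (a + x, b + z, c - z) ∂ν) - deriv c2 (b + z))‖, ?_⟩
    rintro _ ⟨s, hs, rfl⟩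
    refine (Real.le_norm_self _).trans ((norm_integral_le_integral_norm _).trans ?_)
    exact setIntegral_mono_set (hI δ' a b c c hc.2).norm
      (Eventually.of_forall fun z => norm_nonneg _)
      (Ioc_subset_Ioc_right hs.2).eventuallyLE
  intro δ δ'
  rw [BoundedContinuousFunction.norm_le (mul_nonneg (hF0 _) (norm_nonneg _))]
  intro q
  have h1 := hone δ δ' q
  have h2 := hone δ' δ q
  rw [norm_sub_rev] at h2
  rw [BoundedContinuousFunction.sub_apply, Real.norm_eq_abs, abs_le]
  constructor <;> linarith
end
end
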